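/- Let β, m ∈ ℂ and set A := e^{iπ(1/2+m+iβ)/2}/Γ(1/2+m−iβ) and B := e^{−iπ(1/2+m−iβ)/2}/Γ(1/2+m+iβ). Then there exists C > 0 such that for all real x ≥ 1: |𝒥_{β,m}(x) − A·e^{−ix/2}·x^{−iβ} − B·e^{ix/2}·x^{iβ}| ≤ C·x^{−1+|Im(β)|}, where x^{±iβ} := exp(±iβ·ln x). -/

import Mathlib

/-- Pochhammer symbol `(a)_k = a (a+1) ⋯ (a+k-1)`. -/
noncomputable def poch (a : ℂ) (k : ℕ) : ℂ := ∏ i ∈ Finset.range k, (a + i)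

/-- Regularized confluent hypergeometric function
`₁𝐅₁(a;c;z) = Σ_{k=0}^∞ (a)_k z^k / (Γ(c+k)·k!)`. -/
noncomputable def regF1 (a c z : ℂ) : ℂ :=
  ∑' k : ℕ, poch a k * z ^ k / (Complex.Gamma (c + k) * (Nat.factorial k))

/-- The function `𝒥_{β,m}(x) = x^{1/2+m} e^{-ix/2} ₁𝐅₁(1/2+m+iβ; 1+2m; ix)` for `x > 0`. -/
noncomputable def WJ (β m : ℂ) (x : ℝ) : ℂ :=
  (x : ℂ) ^ ((1 : ℂ) / 2 + m) * Complex.exp (-(Complex.I * x) / 2) *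
    regF1 (1 / 2 + m + Complex.I * β) (1 + 2 * m) (Complex.I * x)

/-- `poch` of the successor, peeling off the first factor. -/
lemma mul_poch_add_one (a : ℂ) (k : ℕ) : a * poch (a + 1) k = poch a k * (a + k) := by
  unfold poch
  rw [← Finset.prod_range_succ, Finset.prod_range_succ']
  simp only [Nat.cast_zero, add_zero, Nat.cast_add, Nat.cast_one]
  rw [mul_comm]
  congr 1
  exact Finset.prod_congr rfl fun i _ => by ring

lemma poch_succ (a : ℂ) (k : ℕ) : poch a (k + 1) = poch a k * (a + k) := by
  unfold poch
  rw [Finset.prod_range_succ]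

lemma inv_Gamma_eq (s : ℂ) : (Complex.Gamma s)⁻¹ = s * (Complex.Gamma (s + 1))⁻¹ := by
  simpa only [one_div] using Complex.one_div_Gamma_eq_self_mul_one_div_Gamma_add_one s

/-- The terms of the series defining `regF1`. -/
noncomputable def regF1Term (a c z : ℂ) (k : ℕ) : ℂ :=
  poch a k * z ^ k / (Complex.Gamma (c + k) * (Nat.factorial k))

lemma regF1Term_succ_mul (a c z : ℂ) (k : ℕ) :
    regF1Term a c z (k + 1) * ((c + k) * (k + 1)) = regF1Term a c z k * ((a + k) * z) := by
  unfold regF1Term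
  have h := inv_Gamma_eq (c + k)
  have hk : ((k : ℂ) + 1) ≠ 0 := by exact_mod_cast Nat.succ_ne_zero k
  simp only [div_eq_mul_inv, mul_inv, h, poch_succ, Nat.factorial_succ, Nat.cast_mul, Nat.cast_add,
    Nat.cast_one, pow_succ, add_assoc]
  field_simp

lemma summable_regF1Term (a c z : ℂ) : Summable (regF1Term a c z) := by
  apply summable_of_ratio_norm_eventually_le (r := 1 / 2) (by norm_num)
  obtain ⟨N, hN⟩ := exists_nat_gt (2 * ‖c‖ + ‖a‖ + 8 * ‖z‖)
  filter_upwards [Filter.eventually_ge_atTop N] with k hk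
  have hkN : (N : ℝ) ≤ k := by exact_mod_cast hk
  have hc : (k : ℝ) / 2 ≤ ‖c + k‖ := by
    have h := norm_sub_le (c + k) c
    rw [add_sub_cancel_left, Complex.norm_natCast] at h
    linarith [norm_nonneg a, norm_nonneg z, norm_nonneg c]
  have ha : ‖a + k‖ ≤ 2 * k := by
    have h := norm_add_le a (k : ℂ)
    rw [Complex.norm_natCast] at h
    linarith [norm_nonneg c, norm_nonneg z, norm_nonneg c]
  have hk0 : (0 : ℝ) < k := by linarith [norm_nonneg a, norm_nonneg z, norm_nonneg c]
  have hz : 8 * ‖z‖ ≤ k := by linarith [norm_nonneg a, norm_nonneg c]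
  have h := congrArg norm (regF1Term_succ_mul a c z k)
  have hk1 : ‖(k : ℂ) + 1‖ = k + 1 := by
    rw [← Nat.cast_succ, Complex.norm_natCast]; push_cast; ring
  simp only [norm_mul, hk1] at h
  set u := ‖regF1Term a c z (k + 1)‖
  set v := ‖regF1Term a c z k‖
  have hu : 0 ≤ u := norm_nonneg _
  have hv : 0 ≤ v := norm_nonneg _
  have h1 : u * ((k : ℝ) / 2 * (k + 1)) ≤ v * (2 * k * (k / 8)) := by
    calc _ ≤ u * (‖c + k‖ * (k + 1)) := by gcongr
      _ = _ := h
      _ ≤ _ := by gcongr; linarith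
  have h2 : (k : ℝ) * (u * (k + 1)) ≤ k * (v * k / 2) := by linarith
  have h3 := le_of_mul_le_mul_left h2 hk0
  nlinarith

lemma regF1_eq_tsum (a c z : ℂ) : regF1 a c z = ∑' k, regF1Term a c z k := rfl

lemma regF1_eq_add (a c z : ℂ) :
    regF1 a c z = a * regF1 (a + 1) (c + 1) z + (c - a) * regF1 a (c + 1) z := by
  simp only [regF1_eq_tsum]
  rw [← tsum_mul_left, ← tsum_mul_left, ← Summable.tsum_add
    ((summable_regF1Term _ _ _).mul_left _) ((summable_regF1Term _ _ _).mul_left _)]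
  refine tsum_congr fun k => ?_
  unfold regF1Term
  have h := inv_Gamma_eq (c + k)
  have hc : c + 1 + (k : ℂ) = c + k + 1 := by ring
  simp only [hc, div_eq_mul_inv, mul_inv, h]
  linear_combination (-z ^ k * (Complex.Gamma (c + k + 1))⁻¹ * ((k.factorial : ℂ))⁻¹) *
    mul_poch_add_one a k

lemma regF1_add_one_left (a c z : ℂ) :
    regF1 (a + 1) c z = regF1 a c z + z * regF1 (a + 1) (c + 1) z := by
  simp only [regF1_eq_tsum]
  rw [(summable_regF1Term (a + 1) c z).tsum_eq_zero_add,
    (summable_regF1Term a c z).tsum_eq_zero_add, ← tsum_mul_left, add_assoc,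
    ← Summable.tsum_add ((summable_nat_add_iff 1).2 (summable_regF1Term _ _ _))
      ((summable_regF1Term _ _ _).mul_left _)]
  congr 1
  refine tsum_congr fun k => ?_
  unfold regF1Term
  have hk : ((k : ℂ) + 1) ≠ 0 := by exact_mod_cast Nat.succ_ne_zero k
  have hc : c + 1 + (k : ℂ) = c + (k + 1) := by ring
  have h1 : poch a (k + 1) = a * poch (a + 1) k := by rw [poch_succ, mul_poch_add_one]
  simp only [hc, div_eq_mul_inv, mul_inv, poch_succ (a + 1), h1, Nat.factorial_succ, Nat.cast_mul,
    Nat.cast_add, Nat.cast_one, pow_succ]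
  field_simp
  ring

open Asymptotics Filter Complex

/-- `₁𝐅₁(a; a + b; ix)`. -/
noncomputable def kummerAux (a b : ℂ) (x : ℝ) : ℂ := regF1 a (a + b) (I * x)

/-- The non-oscillating part of the leading asymptotics of `kummerAux`. -/
noncomputable def leadLeft (a b : ℂ) (x : ℝ) : ℂ :=
  exp (I * Real.pi * a / 2) * (x : ℂ) ^ (-a) * (Gamma b)⁻¹

/-- The oscillating part of the leading asymptotics of `kummerAux`. -/
noncomputable def leadRight (a b : ℂ) (x : ℝ) : ℂ :=
  exp (I * x) * exp (-(I * Real.pi * b) / 2) * (x : ℂ) ^ (-b) * (Gamma a)⁻¹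

lemma kummerAux_eq_add (a b : ℂ) (x : ℝ) :
    kummerAux a b x = a * kummerAux (a + 1) b x + b * kummerAux a (b + 1) x := by
  unfold kummerAux
  rw [regF1_eq_add, show a + 1 + b = a + b + 1 by ring, show a + (b + 1) = a + b + 1 by ring,
    show a + b - a = b by ring]

lemma kummerAux_add_one_left (a b : ℂ) (x : ℝ) :
    kummerAux (a + 1) b x = kummerAux a (b + 1) x + I * x * kummerAux (a + 1) (b + 1) x := by
  unfold kummerAux
  rw [regF1_add_one_left, show a + 1 + (b + 1) = a + 1 + b + 1 by ring,
    show a + (b + 1) = a + 1 + b by ring]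

lemma leadRight_mul (a b : ℂ) (x : ℝ) : a * leadRight (a + 1) b x = leadRight a b x := by
  unfold leadRight
  rw [inv_Gamma_eq a]
  ring

lemma leadLeft_mul (a b : ℂ) (x : ℝ) : b * leadLeft a (b + 1) x = leadLeft a b x := by
  unfold leadLeft
  rw [inv_Gamma_eq b]
  ring

lemma ofReal_mul_cpow_neg_add_one {x : ℝ} (hx : x ≠ 0) (a : ℂ) :
    (x : ℂ) * (x : ℂ) ^ (-(a + 1)) = (x : ℂ) ^ (-a) := by
  have hx' : (x : ℂ) ≠ 0 := by exact_mod_cast hx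
  rw [neg_add, ← sub_eq_add_neg, cpow_sub _ _ hx', cpow_one]
  field_simp

lemma I_mul_leadRight {x : ℝ} (hx : x ≠ 0) (a b : ℂ) :
    I * x * leadRight a (b + 1) x = leadRight a b x := by
  unfold leadRight
  rw [← ofReal_mul_cpow_neg_add_one hx b,
    show -(I * Real.pi * (b + 1)) / 2 = -(I * Real.pi * b) / 2 + -Real.pi / 2 * I by ring,
    exp_add, exp_neg_pi_div_two_mul_I]
  linear_combination (-exp (I * x) * exp (-(I * Real.pi * b) / 2) * x * (x : ℂ) ^ (-(b + 1)) *
    (Gamma a)⁻¹) * I_mul_I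

lemma I_mul_leadLeft {x : ℝ} (hx : x ≠ 0) (a b : ℂ) :
    I * x * leadLeft (a + 1) b x = -leadLeft a b x := by
  unfold leadLeft
  rw [← ofReal_mul_cpow_neg_add_one hx a,
    show I * Real.pi * (a + 1) / 2 = I * Real.pi * a / 2 + Real.pi / 2 * I by ring,
    exp_add, exp_pi_div_two_mul_I]
  linear_combination (exp (I * Real.pi * a / 2) * x * (x : ℂ) ^ (-(a + 1)) *
    (Gamma b)⁻¹) * I_mul_I

lemma isBigO_cpow_neg (a : ℂ) :
    (fun x : ℝ => (x : ℂ) ^ (-a)) =O[𝓟 (Set.Ici 1)] fun x : ℝ => x ^ (-a.re) := by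
  refine IsBigO.of_bound 1 (eventually_principal.2 fun x hx => ?_)
  have hx0 : 0 < x := lt_of_lt_of_le one_pos hx
  rw [norm_cpow_eq_rpow_re_of_pos hx0, one_mul, neg_re]
  exact le_abs_self _

lemma isBigO_rpow_rpow {p q : ℝ} (h : p ≤ q) :
    (fun x : ℝ => x ^ p) =O[𝓟 (Set.Ici 1)] fun x : ℝ => x ^ q := by
  refine IsBigO.of_bound 1 (eventually_principal.2 fun x hx => ?_)
  have hx0 : (0 : ℝ) ≤ x := le_trans zero_le_one hx
  rw [Real.norm_of_nonneg (Real.rpow_nonneg hx0 _), Real.norm_of_nonneg (Real.rpow_nonneg hx0 _),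
    one_mul]
  exact Real.rpow_le_rpow_of_exponent_le hx h

lemma isBigO_leadLeft (a b : ℂ) :
    leadLeft a b =O[𝓟 (Set.Ici 1)] fun x : ℝ => x ^ (-a.re) := by
  refine ((isBigO_cpow_neg a).const_mul_left (exp (I * Real.pi * a / 2) * (Gamma b)⁻¹)).congr_left
    fun x => ?_
  unfold leadLeft
  ring

lemma isBigO_leadRight (a b : ℂ) :
    leadRight a b =O[𝓟 (Set.Ici 1)] fun x : ℝ => x ^ (-b.re) := by
  have h : (fun x : ℝ => exp (I * x)) =O[𝓟 (Set.Ici 1)] fun _ : ℝ => (1 : ℝ) :=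
    IsBigO.of_bound 1 (Eventually.of_forall fun x => by rw [norm_exp_I_mul_ofReal]; simp)
  refine ((h.mul ((isBigO_cpow_neg b).const_mul_left
    (exp (-(I * Real.pi * b) / 2) * (Gamma a)⁻¹)))).congr (fun x => ?_) (fun x => one_mul _)
  unfold leadRight
  ring

lemma isBigO_I_mul {f : ℝ → ℂ} {p : ℝ} (h : f =O[𝓟 (Set.Ici 1)] fun x : ℝ => x ^ (p - 1)) :
    (fun x : ℝ => I * x * f x) =O[𝓟 (Set.Ici 1)] fun x : ℝ => x ^ p := by
  have h1 : (fun x : ℝ => I * (x : ℂ)) =O[𝓟 (Set.Ici 1)] fun x : ℝ => x :=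
    IsBigO.of_bound 1 (Eventually.of_forall fun x => by simp)
  refine (h1.mul h).congr' EventuallyEq.rfl (eventually_principal.2 fun x hx => ?_)
  have hx0 : 0 < x := lt_of_lt_of_le one_pos hx
  simp only
  rw [Real.rpow_sub_one hx0.ne']
  field_simp

/-- Leading asymptotics of `kummerAux`, with both contributions. -/
def HasLeading (a b : ℂ) : Prop :=
  (fun x => kummerAux a b x - leadRight a b x - leadLeft a b x) =O[𝓟 (Set.Ici 1)]
    fun x : ℝ => x ^ (-1 + max (-a.re) (-b.re))

/-- Leading asymptotics of `kummerAux` when the oscillating contribution dominates. -/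
def HasLeadingRight (a b : ℂ) : Prop :=
  (fun x => kummerAux a b x - leadRight a b x) =O[𝓟 (Set.Ici 1)]
    fun x : ℝ => x ^ (-b.re - 1)

/-- Leading asymptotics of `kummerAux` when the non-oscillating contribution dominates. -/
def HasLeadingLeft (a b : ℂ) : Prop :=
  (fun x => kummerAux a b x - leadLeft a b x) =O[𝓟 (Set.Ici 1)]
    fun x : ℝ => x ^ (-a.re - 1)

lemma HasLeading.of_add_one {a b : ℂ} (ha : HasLeading (a + 1) b) (hb : HasLeading a (b + 1)) :
    HasLeading a b := by
  unfold HasLeading at *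
  have h1 := ha.trans (isBigO_rpow_rpow (q := -1 + max (-a.re) (-b.re)) (by
    simp only [add_re, one_re]; gcongr; linarith))
  have h2 := hb.trans (isBigO_rpow_rpow (q := -1 + max (-a.re) (-b.re)) (by
    simp only [add_re, one_re]; gcongr; linarith))
  have h3 := (isBigO_leadLeft (a + 1) b).trans
    (isBigO_rpow_rpow (q := -1 + max (-a.re) (-b.re)) (by
      have := le_max_left (-a.re) (-b.re)
      simp only [add_re, one_re]; linarith))
  have h4 := (isBigO_leadRight a (b + 1)).trans
    (isBigO_rpow_rpow (q := -1 + max (-a.re) (-b.re)) (by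
      have := le_max_right (-a.re) (-b.re)
      simp only [add_re, one_re]; linarith))
  refine ((((h1.const_mul_left a).add (h2.const_mul_left b)).add (h3.const_mul_left a)).add
    (h4.const_mul_left b)).congr_left fun x => ?_
  linear_combination -kummerAux_eq_add a b x - leadRight_mul a b x - leadLeft_mul a b x

lemma HasLeadingRight.of_add_one {a b : ℂ} (h1 : HasLeadingRight a (b + 1))
    (h2 : HasLeadingRight (a + 1) (b + 1)) : HasLeadingRight (a + 1) b := by
  unfold HasLeadingRight at *
  have h3 := (isBigO_leadRight a (b + 1))
  have h4 := h1.trans (isBigO_rpow_rpow (q := -b.re - 1) (by simp))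
  have h5 := h3.trans (isBigO_rpow_rpow (q := -b.re - 1) (by simp; linarith))
  have h6 := isBigO_I_mul (p := -b.re - 1) (h2.trans (isBigO_rpow_rpow (by simp; linarith)))
  refine ((h4.add h5).add h6).congr' (eventually_principal.2 fun x hx => ?_) EventuallyEq.rfl
  have hx0 : x ≠ 0 := (lt_of_lt_of_le one_pos hx).ne'
  simp only
  linear_combination -kummerAux_add_one_left a b x - I_mul_leadRight hx0 (a + 1) b

lemma HasLeadingLeft.of_add_one {a b : ℂ} (h1 : HasLeadingLeft (a + 1) b)
    (h2 : HasLeadingLeft (a + 1) (b + 1)) : HasLeadingLeft a (b + 1) := by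
  unfold HasLeadingLeft at *
  have h3 := (isBigO_leadLeft (a + 1) b)
  have h4 := h1.trans (isBigO_rpow_rpow (q := -a.re - 1) (by simp))
  have h5 := h3.trans (isBigO_rpow_rpow (q := -a.re - 1) (by simp; linarith))
  have h6 := isBigO_I_mul (p := -a.re - 1) (h2.trans (isBigO_rpow_rpow (by simp; linarith)))
  refine ((h4.add h5).sub h6).congr' (eventually_principal.2 fun x hx => ?_) EventuallyEq.rfl
  have hx0 : x ≠ 0 := (lt_of_lt_of_le one_pos hx).ne'
  simp only
  linear_combination kummerAux_add_one_left a b x + I_mul_leadLeft hx0 a (b + 1)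

lemma HasLeading.hasLeadingRight {a b : ℂ} (h : HasLeading a b) (hab : b.re + 1 ≤ a.re) :
    HasLeadingRight a b := by
  have hm : max (-a.re) (-b.re) = -b.re := max_eq_right (by linarith)
  unfold HasLeading at h
  rw [hm] at h
  have h1 := h.trans (isBigO_rpow_rpow (q := -b.re - 1) (by linarith))
  have h2 := (isBigO_leadLeft a b).trans (isBigO_rpow_rpow (q := -b.re - 1) (by linarith))
  exact (h1.add h2).congr_left fun x => by ring

lemma HasLeading.hasLeadingLeft {a b : ℂ} (h : HasLeading a b) (hab : a.re + 1 ≤ b.re) :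
    HasLeadingLeft a b := by
  have hm : max (-a.re) (-b.re) = -a.re := max_eq_left (by linarith)
  unfold HasLeading at h
  rw [hm] at h
  have h1 := h.trans (isBigO_rpow_rpow (q := -a.re - 1) (by linarith))
  have h2 := (isBigO_leadRight a b).trans (isBigO_rpow_rpow (q := -a.re - 1) (by linarith))
  exact (h1.add h2).congr_left fun x => by ring

lemma HasLeadingRight.hasLeading {a b : ℂ} (h : HasLeadingRight a b) (hab : b.re + 1 ≤ a.re) :
    HasLeading a b := by
  have hm : max (-a.re) (-b.re) = -b.re := max_eq_right (by linarith)
  unfold HasLeading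
  rw [hm]
  have h1 := h.trans (isBigO_rpow_rpow (q := -1 + -b.re) (by linarith))
  have h2 := (isBigO_leadLeft a b).trans (isBigO_rpow_rpow (q := -1 + -b.re) (by linarith))
  exact h1.sub h2

lemma HasLeadingLeft.hasLeading {a b : ℂ} (h : HasLeadingLeft a b) (hab : a.re + 1 ≤ b.re) :
    HasLeading a b := by
  have hm : max (-a.re) (-b.re) = -a.re := max_eq_left (by linarith)
  unfold HasLeading
  rw [hm]
  have h1 := h.trans (isBigO_rpow_rpow (q := -1 + -a.re) (by linarith))
  have h2 := (isBigO_leadRight a b).trans (isBigO_rpow_rpow (q := -1 + -a.re) (by linarith))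
  exact (h1.sub h2).congr_left fun x => by ring

lemma hasLeadingRight_of_base {K : ℝ}
    (base : ∀ a b : ℂ, K < a.re → K < b.re → HasLeading a b) (n : ℕ) :
    ∀ a b : ℂ, K - n < b.re → b.re + 1 + 2 * n ≤ a.re →
    HasLeadingRight a b := by
  induction n with
  | zero =>
    intro a b hb hab
    simp only [Nat.cast_zero] at hb hab
    exact (base a b (by linarith) (by linarith)).hasLeadingRight (by linarith)
  | succ n ih =>
    intro a b hb hab
    push_cast at hb hab
    have h := HasLeadingRight.of_add_one (a := a - 1) (b := b)
    rw [sub_add_cancel] at h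
    exact h (ih _ _ (by simp; linarith) (by simp; linarith))
      (ih _ _ (by simp; linarith) (by simp; linarith))

lemma hasLeadingLeft_of_base {K : ℝ}
    (base : ∀ a b : ℂ, K < a.re → K < b.re → HasLeading a b) (n : ℕ) :
    ∀ a b : ℂ, K - n < a.re → a.re + 1 + 2 * n ≤ b.re →
    HasLeadingLeft a b := by
  induction n with
  | zero =>
    intro a b hb hab
    simp only [Nat.cast_zero] at hb hab
    exact (base a b (by linarith) (by linarith)).hasLeadingLeft (by linarith)
  | succ n ih =>
    intro a b hb hab
    push_cast at hb hab
    have h := HasLeadingLeft.of_add_one (a := a) (b := b - 1)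
    rw [sub_add_cancel] at h
    exact h (ih _ _ (by simp; linarith) (by simp; linarith))
      (ih _ _ (by simp; linarith) (by simp; linarith))

lemma hasLeading_of_base_of_add_re {K : ℝ}
    (base : ∀ a b : ℂ, K < a.re → K < b.re → HasLeading a b) (n k : ℕ) :
    ∀ a b : ℂ, K - n < a.re → K - n < b.re → 2 * K + 1 + 2 * n - k ≤ a.re + b.re → HasLeading a b := by
  induction k with
  | zero =>
    intro a b ha hb hab
    simp only [Nat.cast_zero] at hab
    have hn : (0 : ℝ) ≤ n := n.cast_nonneg
    by_cases h1 : K < a.re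
    · by_cases h2 : K < b.re
      · exact base a b h1 h2
      · exact (hasLeadingRight_of_base base n a b hb (by linarith)).hasLeading (by linarith)
    · exact (hasLeadingLeft_of_base base n a b ha (by linarith)).hasLeading (by linarith)
  | succ k ih =>
    intro a b ha hb hab
    push_cast at hab
    exact (ih _ _ (by simp; linarith) hb (by simp; linarith)).of_add_one
      (ih _ _ ha (by simp; linarith) (by simp; linarith))

lemma hasLeading_of_base {K : ℝ}
    (base : ∀ a b : ℂ, K < a.re → K < b.re → HasLeading a b) (a b : ℂ) : HasLeading a b := by
  obtain ⟨n, hn⟩ := exists_nat_gt (max (K - a.re) (K - b.re))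
  obtain ⟨k, hk⟩ := exists_nat_gt (2 * K + 1 + 2 * n - (a.re + b.re))
  have := (le_max_left _ _).trans_lt hn
  have := (le_max_right _ _).trans_lt hn
  exact hasLeading_of_base_of_add_re base n k a b (by linarith) (by linarith) (by linarith)

section Watson

lemma one_add_pow_le_exp (N : ℕ) {s : ℝ} (hs : 0 ≤ s) :
    (1 + s) ^ N ≤ 4 ^ N * N.factorial * Real.exp (1 / 4) * Real.exp (s / 4) := by
  have h := Real.pow_div_factorial_le_exp ((1 + s) / 4) (by linarith) N
  rw [div_le_iff₀ (by positivity), add_div, Real.exp_add, ← add_div, div_pow,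
    div_le_iff₀ (by positivity)] at h
  linarith

lemma exists_norm_cpow_le (q : ℂ) : ∃ K : ℝ, 0 ≤ K ∧ ∀ (z : ℂ) (s : ℝ), 0 ≤ s → 1 ≤ ‖z‖ →
    ‖z‖ ≤ 1 + s → ‖z ^ q‖ ≤ K * Real.exp (s / 4) := by
  obtain ⟨N, hN⟩ := exists_nat_gt q.re
  refine ⟨4 ^ N * N.factorial * Real.exp (1 / 4) * Real.exp (Real.pi * |q.im|), by positivity,
    fun z s hs h1 h2 => ?_⟩
  have hz : z ≠ 0 := norm_pos_iff.1 (by linarith)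
  rw [norm_cpow_of_ne_zero hz, div_eq_mul_inv, ← Real.exp_neg]
  have h3 : ‖z‖ ^ q.re ≤ (1 + s) ^ N := by
    calc ‖z‖ ^ q.re ≤ ‖z‖ ^ (N : ℝ) := Real.rpow_le_rpow_of_exponent_le h1 hN.le
      _ = ‖z‖ ^ N := Real.rpow_natCast _ _
      _ ≤ _ := by gcongr
  have h4 : -(z.arg * q.im) ≤ Real.pi * |q.im| := by
    calc -(z.arg * q.im) ≤ |z.arg * q.im| := neg_le_abs _
      _ = |z.arg| * |q.im| := abs_mul _ _
      _ ≤ _ := by gcongr; exact abs_arg_le_pi z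
  calc ‖z‖ ^ q.re * Real.exp (-(z.arg * q.im))
      ≤ (4 ^ N * N.factorial * Real.exp (1 / 4) * Real.exp (s / 4)) *
        Real.exp (Real.pi * |q.im|) := by
        gcongr
        exact h3.trans (one_add_pow_le_exp N hs)
    _ = _ := by ring

variable {σ : ℂ}

lemma one_le_norm_one_add_mul (hσ : σ.re = 0) (s : ℝ) : 1 ≤ ‖1 + σ * s‖ := by
  have h := abs_re_le_norm (1 + σ * s)
  simpa [hσ] using h

lemma norm_one_add_mul_le (hσ1 : ‖σ‖ = 1) {s : ℝ} (hs : 0 ≤ s) : ‖1 + σ * s‖ ≤ 1 + s := by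
  refine (norm_add_le _ _).trans ?_
  simp [hσ1, abs_of_nonneg hs]

lemma one_add_mul_mem_slitPlane (hσ : σ.re = 0) (s : ℝ) : 1 + σ * s ∈ slitPlane := by
  left
  simp [hσ]

lemma exists_norm_one_add_mul_cpow_sub_one_le (hσ : σ.re = 0) (hσ1 : ‖σ‖ = 1) (q : ℂ) :
    ∃ K : ℝ, 0 ≤ K ∧ ∀ s : ℝ, 0 ≤ s → ‖(1 + σ * s) ^ q - 1‖ ≤ K * s * Real.exp (s / 4) := by
  obtain ⟨K, hK, hb⟩ := exists_norm_cpow_le (q - 1)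
  refine ⟨‖q‖ * K, by positivity, fun s hs => ?_⟩
  have h := norm_image_sub_le_of_norm_deriv_le_segment' (a := 0) (b := s)
    (f := fun t : ℝ => (1 + σ * t) ^ q) (f' := fun t => q * (1 + σ * t) ^ (q - 1) * σ)
    (C := ‖q‖ * K * Real.exp (s / 4)) (fun t _ => ?_) (fun t ht => ?_) s ⟨hs, le_rfl⟩
  · simp only [ofReal_zero, mul_zero, add_zero, one_cpow, sub_zero] at h
    linarith
  · have h1 : HasDerivAt (fun z : ℂ => 1 + σ * z) σ t := by
      simpa using ((hasDerivAt_id (t : ℂ)).const_mul σ).const_add 1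
    exact (h1.cpow_const (one_add_mul_mem_slitPlane hσ t)).comp_ofReal.hasDerivWithinAt
  · rw [norm_mul, norm_mul, hσ1, mul_one, mul_assoc]
    gcongr
    refine (hb _ t ht.1 (one_le_norm_one_add_mul hσ t) (norm_one_add_mul_le hσ1 ht.1)).trans ?_
    gcongr
    exact ht.2.le

/-- The integrand of the Laplace-type integrals appearing after rotating the contour. -/
noncomputable def laplaceIntegrand (σ p q : ℂ) (x s : ℝ) : ℂ :=
  (s : ℂ) ^ (p - 1) * exp (-(x * s)) * (1 + σ * s) ^ q

lemma integrableOn_rpow_mul_exp {r c : ℝ} (hr : 0 < r) (hc : 0 < c) :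
    MeasureTheory.IntegrableOn (fun s : ℝ => s ^ (r - 1) * Real.exp (-(c * s))) (Set.Ioi 0) := by
  refine MeasureTheory.Integrable.of_integral_ne_zero ?_
  rw [Real.integral_rpow_mul_exp_neg_mul_Ioi hr hc]
  have := Real.Gamma_pos_of_pos hr
  positivity

lemma integrableOn_laplaceIntegrand (hσ : σ.re = 0) (hσ1 : ‖σ‖ = 1) {p : ℂ} (hp : 0 < p.re)
    (q : ℂ) {x : ℝ} (hx : 1 ≤ x) :
    MeasureTheory.IntegrableOn (laplaceIntegrand σ p q x) (Set.Ioi 0) := by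
  obtain ⟨K, hK, hb⟩ := exists_norm_cpow_le q
  refine MeasureTheory.Integrable.mono'
    ((integrableOn_rpow_mul_exp hp (c := x - 1 / 4) (by linarith)).const_mul K) ?_ ?_
  · refine ContinuousOn.aestronglyMeasurable (fun s hs => ?_) measurableSet_Ioi
    refine ContinuousAt.continuousWithinAt ?_
    unfold laplaceIntegrand
    refine (ContinuousAt.mul ?_ (by fun_prop)).mul ?_
    · exact continuousAt_ofReal_cpow_const _ _ (Or.inr (ne_of_gt hs))
    · exact ContinuousAt.cpow (by fun_prop) continuousAt_const (one_add_mul_mem_slitPlane hσ s)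
  · refine (MeasureTheory.ae_restrict_mem measurableSet_Ioi).mono fun s (hs : 0 < s) => ?_
    unfold laplaceIntegrand
    have h := hb _ s hs.le (one_le_norm_one_add_mul hσ s) (norm_one_add_mul_le hσ1 hs.le)
    rw [norm_mul, norm_mul, norm_cpow_eq_rpow_re_of_pos hs, norm_exp]
    have e : Real.exp (-((x - 1 / 4) * s)) = Real.exp (-(x * s)) * Real.exp (s / 4) := by
      rw [← Real.exp_add]; ring_nf
    rw [e]
    simp only [sub_re, one_re, neg_re, re_ofReal_mul, ofReal_re]
    calc _ ≤ s ^ (p.re - 1) * Real.exp (-(x * s)) * (K * Real.exp (s / 4)) := by gcongr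
      _ = _ := by ring

/-- Watson's lemma to leading order. -/
lemma isBigO_integral_laplaceIntegrand (hσ : σ.re = 0) (hσ1 : ‖σ‖ = 1) {p : ℂ} (hp : 0 < p.re)
    (q : ℂ) :
    (fun x => (∫ s in Set.Ioi 0, laplaceIntegrand σ p q x s) - (x : ℂ) ^ (-p) * Gamma p)
      =O[𝓟 (Set.Ici 1)] fun x : ℝ => x ^ (-p.re - 1) := by
  obtain ⟨K, hK, hb⟩ := exists_norm_one_add_mul_cpow_sub_one_le hσ hσ1 q
  refine IsBigO.of_bound (K * (2 ^ (p.re + 1) * Real.Gamma (p.re + 1)))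
    (eventually_principal.2 fun x (hx : 1 ≤ x) => ?_)
  have hx0 : 0 < x := by linarith
  have hG := Real.Gamma_pos_of_pos (show 0 < p.re + 1 by linarith)
  have h0 : (x : ℂ) ^ (-p) * Gamma p = ∫ s in Set.Ioi 0, laplaceIntegrand σ p 0 x s := by
    have h := integral_cpow_mul_exp_neg_mul_Ioi hp hx0
    simp only [laplaceIntegrand, cpow_zero, mul_one]
    rw [h, one_div, inv_cpow _ _ (by
      rw [arg_ofReal_of_nonneg hx0.le]; exact Real.pi_pos.ne), cpow_neg]
  rw [h0, ← MeasureTheory.integral_sub (integrableOn_laplaceIntegrand hσ hσ1 hp q hx)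
    (integrableOn_laplaceIntegrand hσ hσ1 hp 0 hx)]
  have hp1 : 0 < p.re + 1 := by linarith
  have hc : 0 < x - 1 / 4 := by linarith
  calc _ ≤ ∫ s in Set.Ioi 0, K * (s ^ (p.re + 1 - 1) * Real.exp (-((x - 1 / 4) * s))) := by
        refine MeasureTheory.norm_integral_le_of_norm_le
          ((integrableOn_rpow_mul_exp hp1 hc).const_mul K) ?_
        refine (MeasureTheory.ae_restrict_mem measurableSet_Ioi).mono fun s (hs : 0 < s) => ?_
        unfold laplaceIntegrand
        rw [cpow_zero, ← mul_sub, norm_mul, norm_mul, norm_cpow_eq_rpow_re_of_pos hs, norm_exp]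
        have e : Real.exp (-((x - 1 / 4) * s)) = Real.exp (-(x * s)) * Real.exp (s / 4) := by
          rw [← Real.exp_add]; ring_nf
        rw [e, add_sub_cancel_right]
        simp only [sub_re, one_re, neg_re, re_ofReal_mul, ofReal_re]
        have e2 : s ^ p.re = s ^ (p.re - 1) * s := by
          rw [Real.rpow_sub_one hs.ne']; field_simp
        calc _ ≤ s ^ (p.re - 1) * Real.exp (-(x * s)) * (K * s * Real.exp (s / 4)) := by
              gcongr
              exact hb s hs.le
          _ = _ := by rw [e2]; ring
    _ = K * ((1 / (x - 1 / 4)) ^ (p.re + 1) * Real.Gamma (p.re + 1)) := by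
        rw [MeasureTheory.integral_const_mul, Real.integral_rpow_mul_exp_neg_mul_Ioi hp1 hc]
    _ ≤ K * ((2 / x) ^ (p.re + 1) * Real.Gamma (p.re + 1)) := by
        gcongr ?_ * (?_ ^ _ * _)
        rw [div_le_div_iff₀ hc hx0]
        linarith
    _ = _ := by
        rw [Real.norm_of_nonneg (by positivity), Real.div_rpow (by norm_num) hx0.le,
          show -p.re - 1 = -(p.re + 1) by ring, Real.rpow_neg hx0.le]
        ring

end Watson

section Contour

/-- The integrand of Euler's integral for `kummerAux`. -/
noncomputable def eulerIntegrand (a b : ℂ) (x : ℝ) (t : ℂ) : ℂ :=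
  exp (I * x * t) * t ^ (a - 1) * (1 - t) ^ (b - 1)

variable {a b : ℂ} {x : ℝ}

lemma continuousAt_eulerIntegrand (ha : 1 < a.re) (hb : 1 < b.re) {t : ℂ} (h0 : 0 ≤ t.re)
    (h1 : t.re ≤ 1) : ContinuousAt (eulerIntegrand a b x) t := by
  unfold eulerIntegrand
  refine (ContinuousAt.mul (by fun_prop) ?_).mul ?_
  · exact continuousAt_cpow_const_of_re_pos (Or.inl h0) (by simpa using ha)
  · have h := continuousAt_cpow_const_of_re_pos (z := 1 - t) (w := b - 1)
      (Or.inl (by simpa using h1)) (by simpa using hb)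
    exact h.comp (f := fun t : ℂ => 1 - t) (by fun_prop)

lemma differentiableAt_eulerIntegrand {t : ℂ} (h0 : 0 < t.re) (h1 : t.re < 1) :
    DifferentiableAt ℂ (eulerIntegrand a b x) t := by
  unfold eulerIntegrand
  refine (DifferentiableAt.mul (by fun_prop) ?_).mul ?_
  · exact DifferentiableAt.cpow_const (by fun_prop) (Or.inl h0)
  · exact DifferentiableAt.cpow_const (by fun_prop) (Or.inl (by simpa using h1))

lemma integral_eulerIntegrand_eq_rect (ha : 1 < a.re) (hb : 1 < b.re) (T : ℝ) :
    ∫ u in (0 : ℝ)..1, eulerIntegrand a b x u =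
      (∫ u in (0 : ℝ)..1, eulerIntegrand a b x (u + T * I))
      - I * (∫ y in (0 : ℝ)..T, eulerIntegrand a b x (1 + y * I))
      + I * (∫ y in (0 : ℝ)..T, eulerIntegrand a b x (y * I)) := by
  have h := integral_boundary_rect_eq_zero_of_continuousOn_of_differentiableOn
    (eulerIntegrand a b x) 0 ⟨1, T⟩ ?_ ?_
  · simp only [zero_re, zero_im, ofReal_zero, zero_mul, add_zero, smul_eq_mul, ofReal_one,
      zero_add] at h
    linear_combination h
  · intro t ht
    rw [mem_reProdIm] at ht
    simp only [zero_re, zero_im, Set.uIcc_of_le zero_le_one, Set.mem_Icc] at ht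
    exact (continuousAt_eulerIntegrand ha hb ht.1.1 ht.1.2).continuousWithinAt
  · intro t ht
    rw [mem_reProdIm] at ht
    simp only [zero_re, zero_im, min_eq_left zero_le_one, max_eq_right zero_le_one,
      Set.mem_Ioo] at ht
    exact (differentiableAt_eulerIntegrand ht.1.1 ht.1.2).differentiableWithinAt

lemma tendsto_integral_eulerIntegrand_top (a b : ℂ) (hx : 1 ≤ x) :
    Tendsto (fun T : ℝ => ∫ u in (0 : ℝ)..1, eulerIntegrand a b x (u + T * I)) atTop (nhds 0) := by
  obtain ⟨K, hK, hKb⟩ := exists_norm_cpow_le (a - 1)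
  obtain ⟨L, hL, hLb⟩ := exists_norm_cpow_le (b - 1)
  have hlim : Tendsto (fun T : ℝ => K * L * Real.exp (-(T / 2))) atTop (nhds 0) := by
    have h := (Real.tendsto_exp_neg_atTop_nhds_zero.comp
      (tendsto_id.atTop_div_const (show (0 : ℝ) < 2 by norm_num))).const_mul (K * L)
    simpa using h
  refine squeeze_zero_norm' ?_ hlim
  filter_upwards [eventually_ge_atTop 1] with T hT
  have h := intervalIntegral.norm_integral_le_of_norm_le_const (a := 0) (b := 1)
    (f := fun u : ℝ => eulerIntegrand a b x (u + T * I)) (C := K * L * Real.exp (-(T / 2))) ?_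
  · simpa using h
  intro u hu
  rw [Set.uIoc_of_le zero_le_one] at hu
  have hu0 := hu.1.le
  have hu1 := hu.2
  have hT0 : 0 ≤ T := by linarith
  have n1 : ‖(T : ℂ) * I‖ = T := by simp [abs_of_nonneg hT0]
  have l1 : 1 ≤ ‖(u : ℂ) + T * I‖ := by
    have h := abs_im_le_norm ((u : ℂ) + T * I)
    simp [abs_of_nonneg hT0] at h
    linarith
  have l2 : 1 ≤ ‖1 - ((u : ℂ) + T * I)‖ := by
    have h := abs_im_le_norm (1 - ((u : ℂ) + T * I))
    simp [abs_of_nonneg hT0] at h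
    linarith
  have u1 : ‖(u : ℂ) + T * I‖ ≤ 1 + T := by
    refine (norm_add_le _ _).trans ?_
    rw [n1, norm_real, Real.norm_of_nonneg hu0]
    linarith
  have u2 : ‖1 - ((u : ℂ) + T * I)‖ ≤ 1 + T := by
    rw [← sub_sub]
    refine (norm_sub_le _ _).trans ?_
    rw [n1, ← ofReal_one, ← ofReal_sub, norm_real, Real.norm_of_nonneg (by linarith)]
    linarith
  unfold eulerIntegrand
  rw [norm_mul, norm_mul, norm_exp]
  have e1 : (I * x * (u + T * I)).re = -(x * T) := by simp
  rw [e1]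
  calc _ ≤ Real.exp (-T) * (K * Real.exp (T / 4)) * (L * Real.exp (T / 4)) := by
        gcongr
        · nlinarith
        · exact hKb _ T hT0 l1 u1
        · exact hLb _ T hT0 l2 u2
    _ = K * L * (Real.exp (-T) * Real.exp (T / 4) * Real.exp (T / 4)) := by ring
    _ = _ := by rw [← Real.exp_add, ← Real.exp_add]; ring_nf

lemma ofReal_mul_cpow {y : ℝ} (hy : 0 < y) (z w : ℂ) (hz : z ≠ 0) :
    ((y : ℂ) * z) ^ w = (y : ℂ) ^ w * z ^ w := by
  have hy' : (y : ℂ) ≠ 0 := by exact_mod_cast hy.ne'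
  rw [cpow_def_of_ne_zero (mul_ne_zero hy' hz), cpow_def_of_ne_zero hy', cpow_def_of_ne_zero hz,
    log_ofReal_mul hy hz, ← exp_add, ofReal_log hy.le]
  ring_nf

lemma I_mul_I_cpow_sub_one (a : ℂ) : I * I ^ (a - 1) = exp (I * Real.pi * a / 2) := by
  rw [cpow_sub _ _ I_ne_zero, cpow_one, mul_div_cancel₀ _ I_ne_zero,
    cpow_def_of_ne_zero I_ne_zero, log_I]
  ring_nf

lemma neg_I_mul_neg_I_cpow_sub_one (b : ℂ) :
    -I * (-I) ^ (b - 1) = exp (-(I * Real.pi * b) / 2) := by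
  have h : -I ≠ 0 := neg_ne_zero.2 I_ne_zero
  rw [cpow_sub _ _ h, cpow_one, mul_div_cancel₀ _ h, cpow_def_of_ne_zero h, log_neg_I]
  ring_nf

lemma eulerIntegrand_left (a b : ℂ) (x : ℝ) {y : ℝ} (hy : 0 < y) :
    I * eulerIntegrand a b x (y * I) =
      exp (I * Real.pi * a / 2) * laplaceIntegrand (-I) a (b - 1) x y := by
  unfold eulerIntegrand laplaceIntegrand
  rw [ofReal_mul_cpow hy _ _ I_ne_zero, ← I_mul_I_cpow_sub_one,
    show I * x * (y * I) = -(x * y) by linear_combination (x * y : ℂ) * I_mul_I,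
    show 1 - y * I = 1 + -I * y by ring]
  ring

lemma eulerIntegrand_right (a b : ℂ) (x : ℝ) {y : ℝ} (hy : 0 < y) :
    -I * eulerIntegrand a b x (1 + y * I) =
      exp (I * x) * exp (-(I * Real.pi * b) / 2) * laplaceIntegrand I b (a - 1) x y := by
  unfold eulerIntegrand laplaceIntegrand
  rw [← neg_I_mul_neg_I_cpow_sub_one,
    show I * x * (1 + y * I) = I * x + -(x * y) by linear_combination (x * y : ℂ) * I_mul_I,
    show 1 - (1 + y * I) = y * -I by ring,
    ofReal_mul_cpow hy _ _ (neg_ne_zero.2 I_ne_zero), exp_add, mul_comm (y : ℂ) I]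
  ring

/-- Rotating the contour in Euler's integral onto the two vertical half-lines. -/
lemma integral_eulerIntegrand_eq (ha : 1 < a.re) (hb : 1 < b.re) (hx : 1 ≤ x) :
    ∫ u in (0 : ℝ)..1, eulerIntegrand a b x u =
      exp (I * Real.pi * a / 2) * (∫ s in Set.Ioi 0, laplaceIntegrand (-I) a (b - 1) x s) +
      exp (I * x) * exp (-(I * Real.pi * b) / 2) *
        ∫ s in Set.Ioi 0, laplaceIntegrand I b (a - 1) x s := by
  have hL := MeasureTheory.intervalIntegral_tendsto_integral_Ioi 0
    (integrableOn_laplaceIntegrand (σ := -I) (by simp) (by simp) (p := a) (by linarith) (b - 1) hx)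
    tendsto_id
  have hR := MeasureTheory.intervalIntegral_tendsto_integral_Ioi 0
    (integrableOn_laplaceIntegrand (σ := I) (by simp) (by simp) (p := b) (by linarith) (a - 1) hx)
    tendsto_id
  have hlim := ((tendsto_integral_eulerIntegrand_top a b hx).add
    (hL.const_mul (exp (I * Real.pi * a / 2)))).add
    (hR.const_mul (exp (I * x) * exp (-(I * Real.pi * b) / 2)))
  rw [zero_add] at hlim
  refine tendsto_nhds_unique (tendsto_const_nhds.congr' ?_) hlim
  filter_upwards [eventually_gt_atTop 0] with T hT
  rw [integral_eulerIntegrand_eq_rect ha hb T, sub_eq_add_neg, ← neg_mul]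
  simp only [id, ← intervalIntegral.integral_const_mul]
  have h1 : ∫ y in (0 : ℝ)..T, I * eulerIntegrand a b x (y * I) = ∫ y in (0 : ℝ)..T,
      exp (I * Real.pi * a / 2) * laplaceIntegrand (-I) a (b - 1) x y := by
    rw [intervalIntegral.integral_of_le hT.le, intervalIntegral.integral_of_le hT.le]
    exact MeasureTheory.setIntegral_congr_fun measurableSet_Ioc
      fun y hy => eulerIntegrand_left a b x hy.1
  have h2 : ∫ y in (0 : ℝ)..T, -I * eulerIntegrand a b x (1 + y * I) = ∫ y in (0 : ℝ)..T,
      exp (I * x) * exp (-(I * Real.pi * b) / 2) * laplaceIntegrand I b (a - 1) x y := by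
    rw [intervalIntegral.integral_of_le hT.le, intervalIntegral.integral_of_le hT.le]
    exact MeasureTheory.setIntegral_congr_fun measurableSet_Ioc
      fun y hy => eulerIntegrand_right a b x hy.1
  rw [h1, h2]
  ring

end Contour

lemma poch_mul_Gamma {a : ℂ} (ha : 0 < a.re) (k : ℕ) : poch a k * Gamma a = Gamma (a + k) := by
  induction k with
  | zero => simp [poch]
  | succ k ih =>
    have h : a + k ≠ 0 := fun h => by
      have := congrArg re h
      simp only [add_re, natCast_re, zero_re] at this
      linarith [(Nat.cast_nonneg k : (0 : ℝ) ≤ k)]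
    rw [poch_succ, Nat.cast_succ, ← add_assoc, Gamma_add_one _ h, ← ih]
    ring

/-- Euler's integral representation. -/
lemma Gamma_mul_Gamma_mul_kummerAux {a b : ℂ} (ha : 1 < a.re) (hb : 1 < b.re) (x : ℝ) :
    Gamma a * Gamma b * kummerAux a b x = ∫ u in (0 : ℝ)..1, eulerIntegrand a b x u := by
  have hint := fun k : ℕ => betaIntegral_convergent (u := a + k) (v := b)
    (by simp; linarith [(Nat.cast_nonneg k : (0 : ℝ) ≤ k)]) (by linarith)
  have hF : ∀ (k : ℕ) (u : ℝ), u ∈ Set.uIoc (0 : ℝ) 1 →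
      (I * x * u) ^ k / (k.factorial : ℂ) * ((u : ℂ) ^ (a - 1) * (1 - (u : ℂ)) ^ (b - 1)) =
      (I * x) ^ k / (k.factorial : ℂ) *
        ((u : ℂ) ^ (a + k - 1) * (1 - (u : ℂ)) ^ (b - 1)) := by
    intro k u hu
    rw [Set.uIoc_of_le zero_le_one] at hu
    have hu' : (u : ℂ) ≠ 0 := by exact_mod_cast hu.1.ne'
    rw [show a + k - 1 = a - 1 + k by ring, cpow_add _ _ hu', cpow_natCast]
    ring
  have hint0 : IntervalIntegrable (fun u : ℝ => (u : ℂ) ^ (a - 1) * (1 - (u : ℂ)) ^ (b - 1))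
      MeasureTheory.volume 0 1 := by simpa using hint 0
  have hs := intervalIntegral.hasSum_integral_of_dominated_convergence (a := 0) (b := 1)
    (μ := MeasureTheory.volume) (f := fun u : ℝ => eulerIntegrand a b x u)
    (F := fun (k : ℕ) (u : ℝ) => (I * x * u) ^ k / (k.factorial : ℂ) *
      ((u : ℂ) ^ (a - 1) * (1 - (u : ℂ)) ^ (b - 1)))
    (fun k u => |x| ^ k / k.factorial * ‖(u : ℂ) ^ (a - 1) * (1 - (u : ℂ)) ^ (b - 1)‖)
    (fun k => ?_) (fun k => ?_) ?_ ?_ ?_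
  · unfold kummerAux
    rw [regF1_eq_tsum, ← tsum_mul_left, ← hs.tsum_eq]
    refine tsum_congr fun k => ?_
    have h1 : ∫ u in (0 : ℝ)..1, (I * x * u) ^ k / (k.factorial : ℂ) *
        ((u : ℂ) ^ (a - 1) * (1 - (u : ℂ)) ^ (b - 1)) =
        (I * x) ^ k / (k.factorial : ℂ) * betaIntegral (a + k) b := by
      unfold betaIntegral
      rw [← intervalIntegral.integral_const_mul]
      exact intervalIntegral.integral_congr_ae (Eventually.of_forall (hF k))
    have hk : 0 < (a + k).re := by simp; linarith [(Nat.cast_nonneg k : (0 : ℝ) ≤ k)]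
    have hne := Gamma_ne_zero_of_re_pos (s := a + b + k) (by simp at hk ⊢; linarith)
    have h2 := Gamma_mul_Gamma_eq_betaIntegral hk (t := b) (by linarith)
    rw [show a + k + b = a + b + k by ring] at h2
    have h3 : betaIntegral (a + k) b = Gamma (a + k) * Gamma b / Gamma (a + b + k) := by
      rw [h2]; field_simp
    rw [h1, h3, ← poch_mul_Gamma (by linarith)]
    unfold regF1Term
    field_simp
  · have h := ((hint0.def').aestronglyMeasurable)
    refine MeasureTheory.AEStronglyMeasurable.mul ?_ h
    exact Continuous.aestronglyMeasurable (by fun_prop)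
  · refine Eventually.of_forall fun u hu => ?_
    rw [Set.uIoc_of_le zero_le_one] at hu
    rw [norm_mul, norm_div, norm_pow, Complex.norm_natCast, norm_mul, norm_mul, norm_I,
      one_mul, norm_real, norm_real, Real.norm_eq_abs, Real.norm_of_nonneg hu.1.le]
    have hu0 := hu.1.le
    gcongr
    exact mul_le_of_le_one_right (abs_nonneg x) hu.2
  · exact Eventually.of_forall fun u _ => (Real.summable_pow_div_factorial _).mul_right _
  · simp_rw [tsum_mul_right]
    exact hint0.norm.const_mul _
  · refine Eventually.of_forall fun u _ => ?_
    have h : HasSum (fun k : ℕ => (I * x * u) ^ k / (k.factorial : ℂ)) (exp (I * x * u)) := by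
      rw [exp_eq_exp_ℂ]
      exact NormedSpace.expSeries_div_hasSum_exp (I * x * u)
    simpa only [eulerIntegrand, mul_assoc] using
      h.mul_right ((u : ℂ) ^ (a - 1) * (1 - (u : ℂ)) ^ (b - 1))

lemma hasLeading_of_one_lt_re {a b : ℂ} (ha : 1 < a.re) (hb : 1 < b.re) : HasLeading a b := by
  have hGa := Gamma_ne_zero_of_re_pos (s := a) (by linarith)
  have hGb := Gamma_ne_zero_of_re_pos (s := b) (by linarith)
  have h1 := ((isBigO_integral_laplaceIntegrand (σ := -I) (by simp) (by simp) (p := a)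
    (by linarith) (b - 1)).const_mul_left
      (exp (I * Real.pi * a / 2) * (Gamma a)⁻¹ * (Gamma b)⁻¹)).trans
    (isBigO_rpow_rpow (q := -1 + max (-a.re) (-b.re)) (by linarith [le_max_left (-a.re) (-b.re)]))
  have h2 := ((isBigO_integral_laplaceIntegrand (σ := I) (by simp) (by simp) (p := b)
    (by linarith) (a - 1)).const_mul_left
      (exp (-(I * Real.pi * b) / 2) * (Gamma a)⁻¹ * (Gamma b)⁻¹)).trans
    (isBigO_rpow_rpow (q := -1 + max (-a.re) (-b.re)) (by linarith [le_max_right (-a.re) (-b.re)]))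
  have h : (fun x : ℝ => exp (I * x)) =O[𝓟 (Set.Ici 1)] fun _ : ℝ => (1 : ℝ) :=
    IsBigO.of_bound 1 (Eventually.of_forall fun x => by rw [norm_exp_I_mul_ofReal]; simp)
  have h3 := (h.mul h2).congr_right fun x => one_mul _
  refine (h1.add h3).congr' (eventually_principal.2 fun x (hx : 1 ≤ x) => ?_) EventuallyEq.rfl
  have he := Gamma_mul_Gamma_mul_kummerAux ha hb x
  rw [integral_eulerIntegrand_eq ha hb hx] at he
  have hk : kummerAux a b x = (Gamma a)⁻¹ * (Gamma b)⁻¹ * (Gamma a * Gamma b * kummerAux a b x) := by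
    field_simp
  simp only
  rw [hk, he]
  unfold leadRight leadLeft
  field_simp
  ring

lemma hasLeading (a b : ℂ) : HasLeading a b :=
  hasLeading_of_base (fun _ _ => hasLeading_of_one_lt_re) a b

/-- Asymptotics of `𝒥_{β,m}` at infinity: with
`A = e^{iπ(1/2+m+iβ)/2}/Γ(1/2+m−iβ)` and `B = e^{−iπ(1/2+m−iβ)/2}/Γ(1/2+m+iβ)`,
there is `C > 0` with
`|𝒥_{β,m}(x) − A e^{−ix/2} x^{−iβ} − B e^{ix/2} x^{iβ}| ≤ C x^{−1+|Im β|}` for `x ≥ 1`. -/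
theorem WJ_asymptotics_at_infinity (β m : ℂ) :
    ∃ C : ℝ, 0 < C ∧ ∀ x : ℝ, 1 ≤ x →
      ‖WJ β m x
        - Complex.exp (Complex.I * (Real.pi : ℂ) * (1 / 2 + m + Complex.I * β) / 2) /
            Complex.Gamma (1 / 2 + m - Complex.I * β) *
            Complex.exp (-(Complex.I * x) / 2) * (x : ℂ) ^ (-(Complex.I * β))
        - Complex.exp (-(Complex.I * (Real.pi : ℂ) * (1 / 2 + m - Complex.I * β)) / 2) /
            Complex.Gamma (1 / 2 + m + Complex.I * β) *
            Complex.exp (Complex.I * x / 2) * (x : ℂ) ^ (Complex.I * β)‖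
      ≤ C * x ^ (-1 + |β.im|) := by

  have h1 := hasLeading (1 / 2 + m + I * β) (1 / 2 + m - I * β)
  obtain ⟨C, hC, hb⟩ := h1.exists_pos
  refine ⟨C, hC, fun x hx => ?_⟩
  have hx0 : 0 < x := by linarith
  have hx' : (x : ℂ) ≠ 0 := by exact_mod_cast hx0.ne'
  have hbx := (isBigOWith_principal.1 hb) x hx
  have hmax : max (-(1 / 2 + m + I * β).re) (-(1 / 2 + m - I * β).re) =
      |β.im| - (1 / 2 + m).re := by
    simp only [add_re, sub_re, I_mul_re]
    rcases le_total 0 β.im with h | h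
    · rw [abs_of_nonneg h, max_eq_left (by linarith)]
      ring
    · rw [abs_of_nonpos h, max_eq_right (by linarith)]
      ring
  rw [hmax, Real.norm_of_nonneg (by positivity)] at hbx
  have hfac : ‖(x : ℂ) ^ ((1 : ℂ) / 2 + m) * exp (-(I * x) / 2)‖ = x ^ ((1 : ℂ) / 2 + m).re := by
    rw [norm_mul, norm_cpow_eq_rpow_re_of_pos hx0, norm_exp]
    simp
  have hpow : x ^ (-1 + |β.im|) =
      x ^ ((1 : ℂ) / 2 + m).re * x ^ (-1 + (|β.im| - ((1 : ℂ) / 2 + m).re)) := by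
    rw [← Real.rpow_add hx0]
    ring_nf
  have hA : (x : ℂ) ^ ((1 : ℂ) / 2 + m) * (x : ℂ) ^ (-(1 / 2 + m + I * β)) =
      (x : ℂ) ^ (-(I * β)) := by
    rw [← cpow_add _ _ hx']
    ring_nf
  have hB : (x : ℂ) ^ ((1 : ℂ) / 2 + m) * (x : ℂ) ^ (-(1 / 2 + m - I * β)) =
      (x : ℂ) ^ (I * β) := by
    rw [← cpow_add _ _ hx']
    ring_nf
  have hE : exp (-(I * x) / 2) * exp (I * x) = exp (I * x / 2) := by
    rw [← exp_add]
    ring_nf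
  have hsum : (1 / 2 + m + I * β) + (1 / 2 + m - I * β) = 1 + 2 * m := by ring
  rw [hpow, ← hfac, mul_left_comm]
  refine le_trans (le_of_eq ?_) (mul_le_mul_of_nonneg_left hbx (norm_nonneg _))
  rw [← norm_mul]
  congr 1
  unfold WJ kummerAux leadRight leadLeft
  rw [hsum, ← hA, ← hB, ← hE]
  ring
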